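/- Let R(q) = (q,q^4;q^5)_∞/(q^2,q^3;q^5)_∞ and E(q)=(q;q)_∞. Then R(q)/(R(q^2) R(q^4)) - q^2 R(q^2) R(q^4)/R(q) = E(q) E(q^4) E(q^{10})^{10}/(E(q^2)^2 E(q^5)^5 E(q^{20})^5). -/

import Mathlib

/-- Euler's product E(q) = ∏_{k≥0} (1 - q^{k+1}). -/
noncomputable def E (q : ℂ) : ℂ := ∏' k : ℕ, (1 - q ^ (k + 1))

/-- q-Pochhammer infinite product (a;q)_∞ = ∏_{k≥0} (1 - a q^k). -/
noncomputable def qp (a q : ℂ) : ℂ := ∏' k : ℕ, (1 - a * q ^ k)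

/-- Rogers–Ramanujan function G(q) = 1/((q,q^4;q^5)_∞). -/
noncomputable def G (q : ℂ) : ℂ := 1 / (qp q (q ^ 5) * qp (q ^ 4) (q ^ 5))

/-- Rogers–Ramanujan function H(q) = 1/((q^2,q^3;q^5)_∞). -/
noncomputable def H (q : ℂ) : ℂ := 1 / (qp (q ^ 2) (q ^ 5) * qp (q ^ 3) (q ^ 5))

/-- Rogers–Ramanujan continued fraction product R(q). -/
noncomputable def R (q : ℂ) : ℂ :=
  (qp q (q ^ 5) * qp (q ^ 4) (q ^ 5)) / (qp (q ^ 2) (q ^ 5) * qp (q ^ 3) (q ^ 5))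

open Filter Topology Finset

/-- Gaussian binomial coefficient `[n choose k]` evaluated at `p`. -/
noncomputable def gaussChoose (p : ℂ) : ℕ → ℕ → ℂ
  | _, 0 => 1
  | 0, _ + 1 => 0
  | n + 1, k + 1 => gaussChoose p n k + p ^ (k + 1) * gaussChoose p n (k + 1)

/-- Finite `q`-Pochhammer symbol `(p;p)_n`. -/
noncomputable def qFact (p : ℂ) (n : ℕ) : ℂ := ∏ k ∈ range n, (1 - p ^ (k + 1))

lemma gaussChoose_zero_right (p : ℂ) (n : ℕ) : gaussChoose p n 0 = 1 := by
  cases n <;> simp [gaussChoose]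

lemma gaussChoose_eq_zero_of_lt (p : ℂ) {n k : ℕ} (h : n < k) : gaussChoose p n k = 0 := by
  induction n generalizing k with
  | zero => cases k with
    | zero => omega
    | succ k => simp [gaussChoose]
  | succ n ih => cases k with
    | zero => omega
    | succ k => simp [gaussChoose, ih (show n < k by omega), ih (show n < k + 1 by omega)]

lemma gaussChoose_self (p : ℂ) (n : ℕ) : gaussChoose p n n = 1 := by
  induction n with
  | zero => simp [gaussChoose]
  | succ n ih => simp [gaussChoose, ih, gaussChoose_eq_zero_of_lt p (Nat.lt_succ_self n)]

lemma qFact_succ (p : ℂ) (n : ℕ) : qFact p (n + 1) = qFact p n * (1 - p ^ (n + 1)) := by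
  simp [qFact, prod_range_succ]

lemma gaussChoose_mul_qFact (p : ℂ) (n : ℕ) :
    ∀ k m : ℕ, k + m = n → gaussChoose p n k * (qFact p k * qFact p m) = qFact p n := by
  induction n with
  | zero =>
    intro k m h
    obtain ⟨rfl, rfl⟩ : k = 0 ∧ m = 0 := by omega
    simp [gaussChoose, qFact]
  | succ n ih =>
    intro k m h
    rcases k with _ | k
    · obtain rfl : m = n + 1 := by omega
      simp [gaussChoose, qFact]
    rcases m with _ | m
    · obtain rfl : k = n := by omega
      simp [gaussChoose_self, qFact]
    have h1 := ih k (m + 1) (by omega)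
    have h2 := ih (k + 1) m (by omega)
    have h3 : n + 1 = (k + 1) + (m + 1) := by omega
    simp only [gaussChoose, qFact_succ] at h1 h2 ⊢
    rw [h3, pow_add p (k + 1) (m + 1)]
    linear_combination (1 - p ^ (k + 1)) * h1 + p ^ (k + 1) * (1 - p ^ (m + 1)) * h2

/-- The `q`-binomial theorem. -/
lemma prod_one_add_mul_pow (p x : ℂ) (n : ℕ) :
    ∏ k ∈ range n, (1 + x * p ^ k) =
      ∑ k ∈ range (n + 1), gaussChoose p n k * p ^ (k.choose 2) * x ^ k := by
  induction n generalizing x with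
  | zero => simp [gaussChoose]
  | succ n ih =>
    have h1 : ∏ k ∈ range (n + 1), (1 + x * p ^ k) =
        (1 + x) * ∏ k ∈ range n, (1 + x * p * p ^ k) := by
      rw [prod_range_succ', mul_comm]
      simp [pow_succ', mul_assoc]
    rw [h1, ih, sum_range_succ' _ (n + 1)]
    have h2 : ∀ k, gaussChoose p (n + 1) (k + 1) * p ^ ((k + 1).choose 2) * x ^ (k + 1) =
        x * (gaussChoose p n k * p ^ (k.choose 2) * (x * p) ^ k) +
        gaussChoose p n (k + 1) * p ^ ((k + 1).choose 2) * (x * p) ^ (k + 1) := by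
      intro k
      have : (k + 1).choose 2 = k + k.choose 2 := by
        rw [Nat.choose_succ_succ' k 1, Nat.choose_one_right]
      simp only [gaussChoose, this]
      ring
    simp_rw [h2]
    rw [sum_add_distrib, ← mul_sum, add_mul, one_mul]
    have h3 : ∑ k ∈ range (n + 1), gaussChoose p n k * p ^ (k.choose 2) * (x * p) ^ k =
        ∑ k ∈ range (n + 1),
          gaussChoose p n (k + 1) * p ^ ((k + 1).choose 2) * (x * p) ^ (k + 1) + 1 := by
      have := sum_range_succ' (fun k => gaussChoose p n k * p ^ (k.choose 2) * (x * p) ^ k) (n + 1)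
      rw [sum_range_succ] at this
      simpa [gaussChoose_eq_zero_of_lt p (Nat.lt_succ_self n), gaussChoose_zero_right] using this
    simp only [gaussChoose_zero_right, Nat.choose_zero_succ, pow_zero, mul_one]
    linear_combination h3

/-- General term of the theta series `∑ (-x)^j p^(j(j-1)/2)`. -/
noncomputable def thetaTerm (p x : ℂ) (j : ℤ) : ℂ := (-x) ^ j * p ^ (j * (j - 1) / 2)

lemma two_mul_triangle (j : ℤ) : 2 * (j * (j - 1) / 2) = j * (j - 1) := by
  refine Int.mul_ediv_cancel' ?_
  rcases Int.even_or_odd' j with ⟨k, rfl | rfl⟩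
  · exact ⟨k * (2 * k - 1), by ring⟩
  · exact ⟨(2 * k + 1) * k, by ring⟩

lemma thetaTerm_add_one {p x : ℂ} (hp : p ≠ 0) (hx : x ≠ 0) (j : ℤ) :
    thetaTerm p x (j + 1) = -x * p ^ j * thetaTerm p x j := by
  have h : (j + 1) * (j + 1 - 1) / 2 = j + j * (j - 1) / 2 := by
    have h1 := two_mul_triangle j
    have h2 := two_mul_triangle (j + 1)
    linarith
  rw [thetaTerm, thetaTerm, h, zpow_add₀ hp, zpow_add₀ (neg_ne_zero.mpr hx)]
  simp only [zpow_one]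
  ring

lemma thetaTerm_ne_zero {p x : ℂ} (hp : p ≠ 0) (hx : x ≠ 0) (j : ℤ) : thetaTerm p x j ≠ 0 :=
  mul_ne_zero (zpow_ne_zero _ (neg_ne_zero.mpr hx)) (zpow_ne_zero _ hp)

lemma summable_norm_thetaTerm {p x : ℂ} (hp : p ≠ 0) (hp1 : ‖p‖ < 1) (hx : x ≠ 0) :
    Summable fun j : ℤ => ‖thetaTerm p x j‖ := by
  have hlim : ∀ c : ℂ, Tendsto (fun n : ℕ => ‖c * p ^ n‖) atTop (𝓝 0) := by
    intro c
    simpa using ((tendsto_pow_atTop_nhds_zero_of_norm_lt_one hp1).const_mul c).norm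
  refine Summable.of_nat_of_neg ?_ ?_
  · refine summable_of_ratio_test_tendsto_lt_one zero_lt_one
      (.of_forall fun n => norm_ne_zero_iff.mpr (thetaTerm_ne_zero hp hx _)) ((hlim (-x)).congr ?_)
    intro n
    have h := norm_ne_zero_iff.mpr (thetaTerm_ne_zero hp hx (n : ℤ))
    rw [norm_norm, norm_norm, eq_div_iff h, Nat.cast_succ, thetaTerm_add_one hp hx, norm_mul]
    simp
  · refine summable_of_ratio_test_tendsto_lt_one zero_lt_one
      (.of_forall fun n => norm_ne_zero_iff.mpr (thetaTerm_ne_zero hp hx _))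
      ((hlim ((-x)⁻¹ * p)).congr ?_)
    intro n
    have h := norm_ne_zero_iff.mpr (thetaTerm_ne_zero hp hx (-(n : ℤ)))
    have h2 := thetaTerm_add_one hp hx (-((n + 1 : ℕ) : ℤ))
    rw [show -((n + 1 : ℕ) : ℤ) + 1 = -(n : ℤ) by push_cast; ring] at h2
    rw [norm_norm, norm_norm, eq_div_iff h, h2, ← norm_mul]
    congr 1
    rw [zpow_neg, zpow_natCast]
    field_simp
    ring

lemma prod_one_add_neg_mul_inv_pow {p x : ℂ} (hp : p ≠ 0) (hx : x ≠ 0) (n : ℕ) :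
    ∏ k ∈ range (2 * n), (1 + -x * (p ^ n)⁻¹ * p ^ k) =
      (∏ k ∈ range n, (-x * (p ^ (k + 1))⁻¹)) *
        ((∏ k ∈ range n, (1 - x * p ^ k)) * ∏ k ∈ range n, (1 - p / x * p ^ k)) := by
  rw [two_mul, prod_range_add, ← prod_range_reflect]
  simp only [← prod_mul_distrib]
  refine prod_congr rfl fun k hk => ?_
  have hn : p ^ n = p ^ (n - 1 - k) * p ^ (k + 1) := by
    rw [← pow_add]
    congr 1
    have := Finset.mem_range.mp hk
    omega
  rw [pow_add p n k, hn]
  field_simp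
  ring

lemma thetaTerm_sub_mul_prod {p x : ℂ} (hp : p ≠ 0) (hx : x ≠ 0) (n i : ℕ) :
    thetaTerm p x (i - n) * ∏ k ∈ range n, (-x * (p ^ (k + 1))⁻¹) =
      p ^ (i.choose 2) * (-x * (p ^ n)⁻¹) ^ i := by
  induction i with
  | zero =>
    induction n with
    | zero => simp [thetaTerm]
    | succ n ih =>
      have h := thetaTerm_add_one hp hx (((0 : ℕ) : ℤ) - (n + 1 : ℕ))
      rw [show ((0 : ℕ) : ℤ) - (n + 1 : ℕ) + 1 = ((0 : ℕ) : ℤ) - n by push_cast; ring] at h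
      rw [h] at ih
      rw [prod_range_succ]
      rw [show ((0 : ℕ) : ℤ) - (n + 1 : ℕ) = -((n + 1 : ℕ) : ℤ) by simp, zpow_neg,
        zpow_natCast] at *
      simp only [pow_zero, mul_one] at ih ⊢
      linear_combination ih
  | succ i ih =>
    rw [show ((i + 1 : ℕ) : ℤ) - n = (i - n : ℤ) + 1 by push_cast; ring, thetaTerm_add_one hp hx,
      mul_assoc, ih, Nat.choose_succ_succ' i 1, Nat.choose_one_right, zpow_sub₀ hp]
    simp only [zpow_natCast]
    ring

lemma prod_mul_prod_eq_tsum {p x : ℂ} (hp : p ≠ 0) (hx : x ≠ 0) (n : ℕ) :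
    (∏ k ∈ range n, (1 - x * p ^ k)) * ∏ k ∈ range n, (1 - p / x * p ^ k) =
      ∑' j : ℤ, (if 0 ≤ n + j then gaussChoose p (2 * n) (n + j).toNat else 0) *
        thetaTerm p x j := by
  have hinj : Function.Injective fun i : ℕ => (i : ℤ) - n := fun a b h => by simpa using h
  rw [← hinj.tsum_eq]
  swap
  · intro j hj
    have : 0 ≤ n + j := by
      by_contra h
      simp [h] at hj
    exact ⟨(n + j).toNat, by simp [this]⟩
  rw [tsum_eq_sum (s := range (2 * n + 1))]
  swap
  · intro i hi
    simp only [Finset.mem_range, not_lt] at hi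
    simp [gaussChoose_eq_zero_of_lt p (show 2 * n < i by omega)]
  have hx' : -x ≠ 0 := neg_ne_zero.mpr hx
  have key := prod_one_add_mul_pow p (-x * (p ^ n)⁻¹) (2 * n)
  rw [prod_one_add_neg_mul_inv_pow hp hx] at key
  have hD : ∏ k ∈ range n, (-x * (p ^ (k + 1))⁻¹) ≠ 0 :=
    prod_ne_zero_iff.mpr fun k _ => mul_ne_zero hx' (inv_ne_zero (pow_ne_zero _ hp))
  refine mul_left_cancel₀ hD (key.trans ?_)
  rw [mul_sum]
  refine sum_congr rfl fun i _ => ?_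
  rw [mul_assoc, ← thetaTerm_sub_mul_prod hp hx]
  simp
  ring

lemma multipliable_qp (a : ℂ) {p : ℂ} (hp1 : ‖p‖ < 1) :
    Multipliable fun k : ℕ => 1 - a * p ^ k := by
  have : Summable fun k : ℕ => ‖-(a * p ^ k)‖ := by
    simpa using (summable_geometric_of_lt_one (norm_nonneg p) hp1).mul_left ‖a‖
  simpa [sub_eq_add_neg] using multipliable_one_add_of_summable this

lemma qp_ne_zero {a p : ℂ} (hp1 : ‖p‖ < 1) (h : ∀ k : ℕ, a * p ^ k ≠ 1) : qp a p ≠ 0 := by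
  have hs : Summable fun k : ℕ => ‖-(a * p ^ k)‖ := by
    simpa using (summable_geometric_of_lt_one (norm_nonneg p) hp1).mul_left ‖a‖
  have := tprod_one_add_ne_zero_of_summable (f := fun k : ℕ => -(a * p ^ k))
    (fun k => by rw [← sub_eq_add_neg, sub_ne_zero]; exact (h k).symm) hs
  simpa [qp, sub_eq_add_neg] using this

lemma tendsto_prod_qp (a : ℂ) {p : ℂ} (hp1 : ‖p‖ < 1) :
    Tendsto (fun n => ∏ k ∈ range n, (1 - a * p ^ k)) atTop (𝓝 (qp a p)) :=
  (multipliable_qp a hp1).hasProd.tendsto_prod_nat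

lemma E_eq_qp (p : ℂ) : E p = qp p p := by
  simp only [E, qp, pow_succ']

lemma norm_mul_pow_lt_one {a p : ℂ} (ha : ‖a‖ < 1) (hp1 : ‖p‖ < 1) (k : ℕ) : ‖a * p ^ k‖ < 1 := by
  rw [norm_mul, norm_pow]
  exact mul_lt_one_of_nonneg_of_lt_one_left (norm_nonneg _) ha
    (pow_le_one₀ (norm_nonneg _) hp1.le)

lemma qp_ne_zero_of_norm_lt_one {a p : ℂ} (ha : ‖a‖ < 1) (hp1 : ‖p‖ < 1) : qp a p ≠ 0 :=
  qp_ne_zero hp1 fun k h => by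
    have := norm_mul_pow_lt_one ha hp1 k
    rw [h] at this
    simp at this

lemma E_ne_zero {p : ℂ} (hp1 : ‖p‖ < 1) : E p ≠ 0 :=
  E_eq_qp p ▸ qp_ne_zero_of_norm_lt_one hp1 hp1

lemma qFact_ne_zero {p : ℂ} (hp1 : ‖p‖ < 1) (n : ℕ) : qFact p n ≠ 0 := by
  refine prod_ne_zero_iff.mpr fun k _ h => ?_
  have := norm_mul_pow_lt_one hp1 hp1 k
  rw [← pow_succ', ← sub_eq_zero.mp h] at this
  simp at this

lemma tendsto_qFact {p : ℂ} (hp1 : ‖p‖ < 1) : Tendsto (qFact p) atTop (𝓝 (E p)) := by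
  have := tendsto_prod_qp p hp1
  rw [← E_eq_qp] at this
  simp only [← pow_succ'] at this
  exact this

lemma gaussChoose_add {p : ℂ} (hp1 : ‖p‖ < 1) (k m : ℕ) :
    gaussChoose p (k + m) k = qFact p (k + m) * ((qFact p k)⁻¹ * (qFact p m)⁻¹) := by
  have := gaussChoose_mul_qFact p _ k m rfl
  have h1 := qFact_ne_zero hp1 k
  have h2 := qFact_ne_zero hp1 m
  field_simp
  linear_combination this

lemma exists_norm_gaussChoose_le {p : ℂ} (hp1 : ‖p‖ < 1) :
    ∃ C : ℝ, ∀ n k, ‖gaussChoose p n k‖ ≤ C := by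
  obtain ⟨A, hA⟩ := (tendsto_qFact hp1).norm.bddAbove_range
  obtain ⟨B, hB⟩ := ((tendsto_qFact hp1).inv₀ (E_ne_zero hp1)).norm.bddAbove_range
  replace hA : ∀ n, ‖qFact p n‖ ≤ A := fun n => hA ⟨n, rfl⟩
  replace hB : ∀ n, ‖(qFact p n)⁻¹‖ ≤ B := fun n => hB ⟨n, rfl⟩
  have hA0 := (norm_nonneg _).trans (hA 0)
  have hB0 := (norm_nonneg _).trans (hB 0)
  refine ⟨A * (B * B), fun n k => ?_⟩
  rcases lt_or_ge n k with h | h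
  · rw [gaussChoose_eq_zero_of_lt p h, norm_zero]
    positivity
  · obtain ⟨m, rfl⟩ := Nat.exists_eq_add_of_le h
    rw [gaussChoose_add hp1, norm_mul, norm_mul]
    gcongr
    exacts [hA _, hB _, hB _]

/-- The Jacobi triple product identity. -/
lemma tsum_thetaTerm {p x : ℂ} (hp : p ≠ 0) (hp1 : ‖p‖ < 1) (hx : x ≠ 0) :
    ∑' j, thetaTerm p x j = qp x p * qp (p / x) p * E p := by
  obtain ⟨C, hC⟩ := exists_norm_gaussChoose_le hp1
  have hC0 := (norm_nonneg _).trans (hC 0 0)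
  have hE := E_ne_zero hp1
  have h1 := (tendsto_prod_qp x hp1).mul (tendsto_prod_qp (p / x) hp1)
  simp_rw [prod_mul_prod_eq_tsum hp hx] at h1
  have h2 : Tendsto (fun n : ℕ => ∑' j : ℤ,
      (if 0 ≤ n + j then gaussChoose p (2 * n) (n + j).toNat else 0) * thetaTerm p x j) atTop
      (𝓝 (∑' j : ℤ, (E p)⁻¹ * thetaTerm p x j)) := by
    refine tendsto_tsum_of_dominated_convergence
      ((summable_norm_thetaTerm hp hp1 hx).mul_left C) (fun j => ?_) (.of_forall fun n j => ?_)
    · refine Tendsto.mul_const _ ?_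
      have hq := tendsto_qFact hp1
      have ha : Tendsto (fun n : ℕ => ((n : ℤ) + j).toNat) atTop atTop :=
        tendsto_atTop.mpr fun b => by
          filter_upwards [eventually_ge_atTop (b + j.natAbs)] with n hn
          omega
      have hb : Tendsto (fun n : ℕ => ((n : ℤ) - j).toNat) atTop atTop :=
        tendsto_atTop.mpr fun b => by
          filter_upwards [eventually_ge_atTop (b + j.natAbs)] with n hn
          omega
      have hc : Tendsto (fun n : ℕ => 2 * n) atTop atTop :=
        tendsto_atTop.mpr fun b => by
          filter_upwards [eventually_ge_atTop b] with n hn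
          omega
      have hlim := (hq.comp hc).mul (((hq.comp ha).inv₀ hE).mul ((hq.comp hb).inv₀ hE))
      rw [mul_inv_cancel_left₀ hE] at hlim
      refine hlim.congr' ?_
      filter_upwards [eventually_ge_atTop j.natAbs] with n hn
      rw [if_pos (by omega)]
      have := gaussChoose_add hp1 ((n : ℤ) + j).toNat ((n : ℤ) - j).toNat
      rw [show ((n : ℤ) + j).toNat + ((n : ℤ) - j).toNat = 2 * n by omega] at this
      exact this.symm
    · rw [norm_mul]
      gcongr
      split_ifs
      · exact hC _ _
      · simpa using hC0
  have h3 := tendsto_nhds_unique h1 h2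
  rw [tsum_mul_left] at h3
  rw [h3]
  field_simp

/-- The theta function `(x;p)_∞ (p/x;p)_∞`. -/
noncomputable def theta (x p : ℂ) : ℂ := qp x p * qp (p / x) p

lemma theta_mul_E {p x : ℂ} (hp : p ≠ 0) (hp1 : ‖p‖ < 1) (hx : x ≠ 0) :
    theta x p * E p = ∑' j, thetaTerm p x j := by
  rw [tsum_thetaTerm hp hp1 hx, theta]

lemma theta_mul_E_mul_theta_mul_E {p x y : ℂ} (hp : p ≠ 0) (hp1 : ‖p‖ < 1) (hx : x ≠ 0)
    (hy : y ≠ 0) :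
    HasSum (fun z : ℤ × ℤ => thetaTerm p x z.1 * thetaTerm p y z.2)
      (theta x p * theta y p * E p ^ 2) := by
  have h1 := summable_norm_thetaTerm hp hp1 hx
  have h2 := summable_norm_thetaTerm hp hp1 hy
  have := tsum_mul_tsum_of_summable_norm h1 h2
  rw [← theta_mul_E hp hp1 hx, ← theta_mul_E hp hp1 hy] at this
  rw [show theta x p * theta y p * E p ^ 2 = theta x p * E p * (theta y p * E p) by ring, this]
  exact (summable_mul_of_summable_norm h1 h2).hasSum

lemma thetaTerm_neg (p x : ℂ) (j : ℤ) : thetaTerm p (-x) j = x ^ j * p ^ (j * (j - 1) / 2) := by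
  rw [thetaTerm, neg_neg]

lemma thetaTerm_eq (p x : ℂ) (j : ℤ) :
    thetaTerm p x j = (-1) ^ j * (x ^ j * p ^ (j * (j - 1) / 2)) := by
  rw [thetaTerm, neg_eq_neg_one_mul, mul_zpow, mul_assoc]

lemma neg_one_zpow_sub (s t : ℤ) : (-1 : ℂ) ^ (s - t) = (-1) ^ s * (-1) ^ t := by
  rw [zpow_sub₀ (by simp), div_eq_mul_inv, ← zpow_neg, zpow_neg, ← inv_zpow, inv_neg_one]

lemma norm_sq_lt_one {p : ℂ} (hp1 : ‖p‖ < 1) : ‖p ^ 2‖ < 1 := by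
  rw [norm_pow]
  exact pow_lt_one₀ (norm_nonneg _) hp1 two_ne_zero

lemma theta_mul_theta_neg_add {p x y : ℂ} (hp : p ≠ 0) (hp1 : ‖p‖ < 1) (hx : x ≠ 0) (hy : y ≠ 0) :
    (theta x p * theta (-y) p + theta (-x) p * theta y p) * E p ^ 2 =
      2 * (theta (x * y) (p ^ 2) * theta (p * x / y) (p ^ 2)) * E (p ^ 2) ^ 2 := by
  have hL := (theta_mul_E_mul_theta_mul_E hp hp1 hx (neg_ne_zero.mpr hy)).add
    (theta_mul_E_mul_theta_mul_E hp hp1 (neg_ne_zero.mpr hx) hy)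
  have hR := (theta_mul_E_mul_theta_mul_E (pow_ne_zero 2 hp) (norm_sq_lt_one hp1)
    (mul_ne_zero hx hy) (div_ne_zero (mul_ne_zero hp hx) hy)).mul_left 2
  have hinj : Function.Injective fun z : ℤ × ℤ => (z.1 + z.2, z.1 - z.2) := by
    rintro ⟨a, b⟩ ⟨c, d⟩ h
    simp only [Prod.mk.injEq] at h ⊢
    omega
  rw [← hinj.hasSum_iff] at hL
  · have := hL.unique (hR.congr_fun ?_)
    · linear_combination this
    rintro ⟨s, t⟩
    have he : (s + t) * (s + t - 1) / 2 + (s - t) * (s - t - 1) / 2 =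
        2 * (s * (s - 1) / 2) + 2 * (t * (t - 1) / 2) + t := by
      linarith [two_mul_triangle s, two_mul_triangle t, two_mul_triangle (s + t),
        two_mul_triangle (s - t)]
    have he' : p ^ ((s + t) * (s + t - 1) / 2) * p ^ ((s - t) * (s - t - 1) / 2) =
        (p ^ 2) ^ (s * (s - 1) / 2) * (p ^ 2) ^ (t * (t - 1) / 2) * p ^ t := by
      rw [← zpow_add₀ hp, he, zpow_add₀ hp, zpow_add₀ hp, zpow_mul, zpow_mul]
      norm_cast
    simp only [Function.comp_apply, thetaTerm_neg]
    rw [thetaTerm_eq p x, thetaTerm_eq p y, thetaTerm_eq (p ^ 2), thetaTerm_eq (p ^ 2),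
      neg_one_zpow_sub, zpow_add₀ (by simp), zpow_add₀ hx, zpow_sub₀ hy, div_zpow, mul_zpow,
      mul_zpow]
    linear_combination (2 * (-1) ^ s * (-1) ^ t * (x ^ s * x ^ t) * (y ^ s / y ^ t)) * he'
  · rintro ⟨m, n⟩ h
    simp only [thetaTerm_neg]
    rw [thetaTerm_eq p x, thetaTerm_eq p y]
    have hodd : ¬ Even (m + n) := fun ⟨s, hs⟩ => h ⟨(s, m - s), by simp; omega⟩
    rcases Int.even_or_odd m with hm | hm <;> rcases Int.even_or_odd n with hn | hn
    · exact absurd (hm.add hn) hodd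
    · rw [hm.neg_one_zpow, hn.neg_one_zpow]
      ring
    · rw [hm.neg_one_zpow, hn.neg_one_zpow]
      ring
    · exact absurd (hm.add_odd hn) hodd

lemma theta_mul_theta_neg_sub {p x y : ℂ} (hp : p ≠ 0) (hp1 : ‖p‖ < 1) (hx : x ≠ 0) (hy : y ≠ 0) :
    (theta x p * theta (-y) p - theta (-x) p * theta y p) * E p ^ 2 =
      -2 * x * (theta (p * x * y) (p ^ 2) * theta (p ^ 2 * x / y) (p ^ 2)) * E (p ^ 2) ^ 2 := by
  have hL := (theta_mul_E_mul_theta_mul_E hp hp1 hx (neg_ne_zero.mpr hy)).sub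
    (theta_mul_E_mul_theta_mul_E hp hp1 (neg_ne_zero.mpr hx) hy)
  have hp2 := pow_ne_zero 2 hp
  have hR := (theta_mul_E_mul_theta_mul_E hp2 (norm_sq_lt_one hp1)
    (mul_ne_zero (mul_ne_zero hp hx) hy) (div_ne_zero (mul_ne_zero hp2 hx) hy)).mul_left (-2 * x)
  have hinj : Function.Injective fun z : ℤ × ℤ => (z.1 + z.2 + 1, z.1 - z.2) := by
    rintro ⟨a, b⟩ ⟨c, d⟩ h
    simp only [Prod.mk.injEq] at h ⊢
    omega
  rw [← hinj.hasSum_iff] at hL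
  · have := hL.unique (hR.congr_fun ?_)
    · linear_combination this
    rintro ⟨s, t⟩
    have he : (s + t + 1) * (s + t + 1 - 1) / 2 + (s - t) * (s - t - 1) / 2 =
        2 * (s * (s - 1) / 2) + s + (2 * (t * (t - 1) / 2) + 2 * t) := by
      linarith [two_mul_triangle s, two_mul_triangle t, two_mul_triangle (s + t + 1),
        two_mul_triangle (s - t)]
    have he' : p ^ ((s + t + 1) * (s + t + 1 - 1) / 2) * p ^ ((s - t) * (s - t - 1) / 2) =
        (p ^ 2) ^ (s * (s - 1) / 2) * p ^ s * ((p ^ 2) ^ (t * (t - 1) / 2) * (p ^ 2) ^ t) := by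
      rw [← zpow_add₀ hp, he, zpow_add₀ hp, zpow_add₀ hp, zpow_add₀ hp, zpow_mul, zpow_mul,
        zpow_mul]
      norm_cast
    simp only [Function.comp_apply, thetaTerm_neg]
    rw [thetaTerm_eq p x, thetaTerm_eq p y, thetaTerm_eq (p ^ 2), thetaTerm_eq (p ^ 2),
      neg_one_zpow_sub, zpow_add₀ (by simp), zpow_add₀ (by simp), zpow_add₀ hx, zpow_add₀ hx,
      zpow_sub₀ hy, div_zpow, mul_zpow, mul_zpow, mul_zpow, zpow_one, zpow_one]
    linear_combination (-2 * (-1) ^ s * (-1) ^ t * (x ^ s * x ^ t * x) * (y ^ s / y ^ t)) * he'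
  · rintro ⟨m, n⟩ h
    simp only [thetaTerm_neg]
    rw [thetaTerm_eq p x, thetaTerm_eq p y]
    have hodd : ¬ Odd (m + n) := fun ⟨s, hs⟩ => h ⟨(s, m - s - 1), by simp; omega⟩
    rcases Int.even_or_odd m with hm | hm <;> rcases Int.even_or_odd n with hn | hn
    · rw [hm.neg_one_zpow, hn.neg_one_zpow]
      ring
    · exact absurd (hm.add_odd hn) hodd
    · exact absurd (hm.add_even hn) hodd
    · rw [hm.neg_one_zpow, hn.neg_one_zpow]
      ring

lemma qp_split (a : ℂ) {p : ℂ} (hp1 : ‖p‖ < 1) :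
    qp a p = qp a (p ^ 2) * qp (a * p) (p ^ 2) := by
  have h0 : ∀ k, 1 - a * (p ^ 2) ^ k = 1 - a * p ^ (2 * k) := fun k => by rw [pow_mul]
  have h1 : ∀ k, 1 - a * p * (p ^ 2) ^ k = 1 - a * p ^ (2 * k + 1) := fun k => by ring
  have h2 := multipliable_qp a (norm_sq_lt_one hp1)
  have h3 := multipliable_qp (a * p) (norm_sq_lt_one hp1)
  simp_rw [qp, h0, h1] at h2 h3 ⊢
  exact (tprod_even_mul_odd (f := fun k => 1 - a * p ^ k) h2 h3).symm

lemma qp_mul_qp_neg (a : ℂ) {p : ℂ} (hp1 : ‖p‖ < 1) :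
    qp a p * qp (-a) p = qp (a ^ 2) (p ^ 2) := by
  rw [qp, qp, qp, ← (multipliable_qp a hp1).tprod_mul (multipliable_qp (-a) hp1)]
  exact tprod_congr fun k => by ring

lemma theta_mul_theta_neg (x : ℂ) {p : ℂ} (hp1 : ‖p‖ < 1) :
    theta x p * theta (-x) p = theta (x ^ 2) (p ^ 2) := by
  rw [theta, theta, theta, ← qp_mul_qp_neg x hp1, ← div_pow, ← qp_mul_qp_neg (p / x) hp1, div_neg]
  ring

lemma theta_div (x : ℂ) {p : ℂ} (hp : p ≠ 0) : theta (p / x) p = theta x p := by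
  rw [theta, theta, div_div_cancel₀ hp, mul_comm]

/-- The product `(q,q^4;q^5)_∞`. -/
noncomputable def rrNum (q : ℂ) : ℂ := qp q (q ^ 5) * qp (q ^ 4) (q ^ 5)

/-- The product `(q^2,q^3;q^5)_∞`. -/
noncomputable def rrDen (q : ℂ) : ℂ := qp (q ^ 2) (q ^ 5) * qp (q ^ 3) (q ^ 5)

/-- The product `(q,q^9;q^10)_∞`. -/
noncomputable def rrOdd₁ (q : ℂ) : ℂ := qp q (q ^ 10) * qp (q ^ 9) (q ^ 10)

/-- The product `(q^3,q^7;q^10)_∞`. -/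
noncomputable def rrOdd₃ (q : ℂ) : ℂ := qp (q ^ 3) (q ^ 10) * qp (q ^ 7) (q ^ 10)

lemma R_eq (q : ℂ) : R q = rrNum q / rrDen q := rfl

lemma norm_pow_lt_one {q : ℂ} (hq1 : ‖q‖ < 1) {n : ℕ} (hn : n ≠ 0) : ‖q ^ n‖ < 1 := by
  rw [norm_pow]
  exact pow_lt_one₀ (norm_nonneg _) hq1 hn

lemma qp_pow_ne_zero {q : ℂ} (hq1 : ‖q‖ < 1) {m n : ℕ} (hm : m ≠ 0) (hn : n ≠ 0) :
    qp (q ^ m) (q ^ n) ≠ 0 :=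
  qp_ne_zero_of_norm_lt_one (norm_pow_lt_one hq1 hm) (norm_pow_lt_one hq1 hn)

lemma rrNum_ne_zero {q : ℂ} (hq1 : ‖q‖ < 1) : rrNum q ≠ 0 :=
  mul_ne_zero (qp_ne_zero_of_norm_lt_one hq1 (norm_pow_lt_one hq1 (by simp)))
    (qp_pow_ne_zero hq1 (by simp) (by simp))

lemma rrDen_ne_zero {q : ℂ} (hq1 : ‖q‖ < 1) : rrDen q ≠ 0 :=
  mul_ne_zero (qp_pow_ne_zero hq1 (by simp) (by simp)) (qp_pow_ne_zero hq1 (by simp) (by simp))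

lemma rrNum_eq {q : ℂ} (hq1 : ‖q‖ < 1) : rrNum q = rrOdd₁ q * rrDen (q ^ 2) := by
  have h5 : ‖q ^ 5‖ < 1 := norm_pow_lt_one hq1 (by simp)
  rw [rrNum, rrOdd₁, rrDen, qp_split q h5, qp_split (q ^ 4) h5]
  simp only [← pow_mul, ← pow_add, ← pow_succ']
  norm_num
  ring

lemma rrDen_eq {q : ℂ} (hq1 : ‖q‖ < 1) : rrDen q = rrOdd₃ q * rrNum (q ^ 2) := by
  have h5 : ‖q ^ 5‖ < 1 := norm_pow_lt_one hq1 (by simp)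
  rw [rrNum, rrOdd₃, rrDen, qp_split (q ^ 2) h5, qp_split (q ^ 3) h5]
  simp only [← pow_mul, ← pow_add]
  norm_num
  ring

lemma rrOdd₁_mul_neg {q : ℂ} (hq1 : ‖q‖ < 1) : rrOdd₁ q * rrOdd₁ (-q) = rrOdd₁ (q ^ 2) := by
  have h10 : ‖q ^ 10‖ < 1 := norm_pow_lt_one hq1 (by simp)
  have h1 := qp_mul_qp_neg q h10
  have h9 := qp_mul_qp_neg (q ^ 9) h10
  rw [rrOdd₁, rrOdd₁, rrOdd₁, pow_right_comm, pow_right_comm q 2 9, ← h1, ← h9,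
    Odd.neg_pow (n := 9) (by decide), Even.neg_pow (n := 10) (by decide)]
  ring

lemma rrOdd₃_mul_neg {q : ℂ} (hq1 : ‖q‖ < 1) : rrOdd₃ q * rrOdd₃ (-q) = rrOdd₃ (q ^ 2) := by
  have h10 : ‖q ^ 10‖ < 1 := norm_pow_lt_one hq1 (by simp)
  have h3 := qp_mul_qp_neg (q ^ 3) h10
  have h7 := qp_mul_qp_neg (q ^ 7) h10
  rw [rrOdd₃, rrOdd₃, rrOdd₃, pow_right_comm q 2 10, pow_right_comm q 2 3, pow_right_comm q 2 7,
    ← h3, ← h7, Odd.neg_pow (n := 3) (by decide), Odd.neg_pow (n := 7) (by decide),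
    Even.neg_pow (by decide)]
  ring

lemma rrNum_eq_theta {q : ℂ} (hq : q ≠ 0) : rrNum q = theta q (q ^ 5) := by
  rw [rrNum, theta]
  congr 2
  field_simp

lemma rrDen_eq_theta {q : ℂ} (hq : q ≠ 0) : rrDen q = theta (q ^ 2) (q ^ 5) := by
  rw [rrDen, theta]
  congr 2
  field_simp

lemma rrOdd₁_eq_theta {q : ℂ} (hq : q ≠ 0) : rrOdd₁ q = theta q (q ^ 10) := by
  rw [rrOdd₁, theta]
  congr 2
  field_simp

lemma rrOdd₃_eq_theta {q : ℂ} (hq : q ≠ 0) : rrOdd₃ q = theta (q ^ 3) (q ^ 10) := by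
  rw [rrOdd₃, theta]
  congr 2
  field_simp

lemma rrNum_mul_rrDen {q : ℂ} (hq1 : ‖q‖ < 1) : rrNum q * rrDen q * E (q ^ 5) = E q := by
  have h5 : ‖q ^ 5‖ < 1 := norm_pow_lt_one hq1 (by simp)
  have hL := ((((tendsto_prod_qp q h5).mul (tendsto_prod_qp (q ^ 4) h5)).mul
    ((tendsto_prod_qp (q ^ 2) h5).mul (tendsto_prod_qp (q ^ 3) h5))).mul
    (tendsto_prod_qp (q ^ 5) h5))
  have hR := (tendsto_prod_qp q hq1).comp
    (tendsto_id.const_mul_atTop' (show 0 < 5 by simp) : Tendsto (fun n : ℕ => 5 * n) atTop atTop)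
  rw [rrNum, rrDen, E_eq_qp, E_eq_qp q]
  refine tendsto_nhds_unique hL (hR.congr fun n => ?_)
  simp only [Function.comp_apply]
  induction n with
  | zero => simp
  | succ n ih =>
    rw [mul_add, mul_one]
    simp only [prod_range_succ, ih]
    ring

lemma E_mul_E_neg {q : ℂ} (hq1 : ‖q‖ < 1) : E q * E (-q) * E (q ^ 4) = E (q ^ 2) ^ 3 := by
  have h2 := norm_sq_lt_one hq1
  have hn : ‖-q‖ < 1 := by rwa [norm_neg]
  have e1 : E q = qp q (q ^ 2) * E (q ^ 2) := by
    rw [E_eq_qp q, qp_split q hq1, E_eq_qp, ← sq]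
  have e2 : E (-q) = qp (-q) (q ^ 2) * E (q ^ 2) := by
    rw [E_eq_qp, qp_split _ hn, E_eq_qp, ← sq, neg_sq]
  have e3 : E (q ^ 2) = qp (q ^ 2) (q ^ 4) * E (q ^ 4) := by
    rw [E_eq_qp, qp_split _ h2, E_eq_qp, ← pow_mul, ← pow_add]
  have e4 := qp_mul_qp_neg q h2
  rw [← pow_mul] at e4
  rw [e1, e2]
  linear_combination E (q ^ 2) ^ 2 * E (q ^ 4) * e4 - E (q ^ 2) ^ 2 * e3

/-- `R(q)^2 + R(q^2)` as a product. -/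
lemma R_sq_add {q : ℂ} (hq : q ≠ 0) (hq1 : ‖q‖ < 1) :
    (R q ^ 2 + R (q ^ 2)) * (rrNum (q ^ 2) * E (q ^ 5) ^ 2) = 2 * rrNum q * E (q ^ 10) ^ 2 := by
  have h5 : ‖q ^ 5‖ < 1 := norm_pow_lt_one hq1 (by simp)
  have key := theta_mul_theta_neg_add (pow_ne_zero 5 hq) h5 hq (pow_ne_zero 2 hq)
  have hg := theta_mul_theta_neg q h5
  have hh := theta_mul_theta_neg (q ^ 2) h5
  have hv := rrDen_eq hq1
  have e1 : theta (q * q ^ 2) ((q ^ 5) ^ 2) = rrOdd₃ q := by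
    rw [rrOdd₃_eq_theta hq]
    congr 1 <;> ring
  have e2 : theta (q ^ 5 * q / q ^ 2) ((q ^ 5) ^ 2) = rrDen (q ^ 2) := by
    rw [rrDen_eq_theta (pow_ne_zero 2 hq)]
    congr 1
    · field_simp
    · ring
  have e3 : theta (q ^ 2) ((q ^ 5) ^ 2) = rrNum (q ^ 2) := by
    rw [rrNum_eq_theta (pow_ne_zero 2 hq)]
    congr 1
    ring
  have e4 : theta ((q ^ 2) ^ 2) ((q ^ 5) ^ 2) = rrDen (q ^ 2) := by
    rw [rrDen_eq_theta (pow_ne_zero 2 hq)]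
    congr 1
    ring
  rw [e3, ← rrNum_eq_theta hq] at hg
  rw [e4, ← rrDen_eq_theta hq] at hh
  rw [e1, e2, ← rrNum_eq_theta hq, ← rrDen_eq_theta hq, ← pow_mul] at key
  have := rrDen_ne_zero hq1
  have := rrDen_ne_zero (norm_sq_lt_one hq1)
  have := rrNum_ne_zero hq1
  have := rrNum_ne_zero (norm_sq_lt_one hq1)
  rw [R_eq, R_eq]
  norm_num at key
  have hpoly : (rrNum q ^ 2 * rrDen (q ^ 2) + rrDen q ^ 2 * rrNum (q ^ 2)) *
      (rrNum (q ^ 2) * E (q ^ 5) ^ 2) =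
      2 * rrNum q * E (q ^ 10) ^ 2 * (rrDen q ^ 2 * rrDen (q ^ 2)) := by
    linear_combination rrNum q * rrDen q * rrNum (q ^ 2) * key -
      2 * rrNum q * rrDen q * rrDen (q ^ 2) * E (q ^ 10) ^ 2 * hv -
      rrNum q ^ 2 * rrNum (q ^ 2) * E (q ^ 5) ^ 2 * hh -
      rrDen q ^ 2 * rrNum (q ^ 2) * E (q ^ 5) ^ 2 * hg
  field_simp
  linear_combination hpoly

/-- `R(q)^2 - R(q^2)` as a product. -/
lemma R_sq_sub {q : ℂ} (hq : q ≠ 0) (hq1 : ‖q‖ < 1) :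
    (R (q ^ 2) - R q ^ 2) * (rrDen q * rrDen (q ^ 2) ^ 2 * E (q ^ 5) ^ 2) =
      2 * q * rrNum q ^ 2 * rrNum (q ^ 2) * E (q ^ 10) ^ 2 := by
  have h5 : ‖q ^ 5‖ < 1 := norm_pow_lt_one hq1 (by simp)
  have key := theta_mul_theta_neg_sub (pow_ne_zero 5 hq) h5 hq (pow_ne_zero 2 hq)
  have hg := theta_mul_theta_neg q h5
  have hh := theta_mul_theta_neg (q ^ 2) h5
  have hu := rrNum_eq hq1
  have e1 : theta (q ^ 5 * q * q ^ 2) ((q ^ 5) ^ 2) = rrNum (q ^ 2) := by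
    rw [rrNum_eq_theta (pow_ne_zero 2 hq), ← theta_div _ (pow_ne_zero 5 (pow_ne_zero 2 hq))]
    congr 1
    · field_simp
    · ring
  have e2 : theta ((q ^ 5) ^ 2 * q / q ^ 2) ((q ^ 5) ^ 2) = rrOdd₁ q := by
    rw [rrOdd₁_eq_theta hq, ← theta_div q (pow_ne_zero 10 hq)]
    congr 1
    · field_simp
    · ring
  have e3 : theta (q ^ 2) ((q ^ 5) ^ 2) = rrNum (q ^ 2) := by
    rw [rrNum_eq_theta (pow_ne_zero 2 hq)]
    congr 1
    ring
  have e4 : theta ((q ^ 2) ^ 2) ((q ^ 5) ^ 2) = rrDen (q ^ 2) := by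
    rw [rrDen_eq_theta (pow_ne_zero 2 hq)]
    congr 1
    ring
  rw [e3, ← rrNum_eq_theta hq] at hg
  rw [e4, ← rrDen_eq_theta hq] at hh
  rw [e1, e2, ← rrNum_eq_theta hq, ← rrDen_eq_theta hq, ← pow_mul] at key
  have := rrDen_ne_zero hq1
  have := rrDen_ne_zero (norm_sq_lt_one hq1)
  rw [R_eq, R_eq]
  norm_num at key
  have hpoly : (rrNum (q ^ 2) * rrDen q ^ 2 - rrNum q ^ 2 * rrDen (q ^ 2)) *
      (rrDen (q ^ 2) * E (q ^ 5) ^ 2) =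
      2 * q * rrNum q ^ 2 * rrNum (q ^ 2) * E (q ^ 10) ^ 2 * rrDen q := by
    linear_combination -rrNum q * rrDen q * rrDen (q ^ 2) * key -
      2 * q * rrNum q * rrNum (q ^ 2) * rrDen q * E (q ^ 10) ^ 2 * hu +
      rrNum q ^ 2 * rrDen (q ^ 2) * E (q ^ 5) ^ 2 * hh -
      rrDen q ^ 2 * rrDen (q ^ 2) * E (q ^ 5) ^ 2 * hg
  field_simp
  linear_combination hpoly

/-- The modular equation between `R(q)` and `R(q^2)`. -/
lemma R_modular_equation {q : ℂ} (hq1 : ‖q‖ < 1) :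
    R (q ^ 2) - R q ^ 2 = q * R q * R (q ^ 2) ^ 2 * (R (q ^ 2) + R q ^ 2) := by
  rcases eq_or_ne q 0 with rfl | hq
  · simp [R, qp]
  have hadd := R_sq_add hq hq1
  have hsub := R_sq_sub hq hq1
  have h1 := rrDen_ne_zero hq1
  have h2 := rrDen_ne_zero (norm_sq_lt_one hq1)
  have h3 := rrNum_ne_zero (norm_sq_lt_one hq1)
  have hE := E_ne_zero (norm_pow_lt_one hq1 (n := 5) (by simp))
  have hg : rrNum q = R q * rrDen q := by rw [R_eq]; field_simp
  have hg2 : rrNum (q ^ 2) = R (q ^ 2) * rrDen (q ^ 2) := by rw [R_eq]; field_simp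
  have h4 : R (q ^ 2) ≠ 0 := by rw [R_eq]; exact div_ne_zero h3 h2
  have hc : rrDen q * rrDen (q ^ 2) ^ 2 * E (q ^ 5) ^ 2 ≠ 0 := by positivity
  rw [hg, hg2] at hadd hsub
  refine mul_right_cancel₀ hc ?_
  linear_combination hsub - q * R q * R (q ^ 2) * rrDen q * rrDen (q ^ 2) * hadd

lemma rrNum_mul_neg {q : ℂ} (hq1 : ‖q‖ < 1) :
    rrNum q * rrNum (-q) * rrDen (q ^ 4) = rrDen (q ^ 2) ^ 2 * rrNum (q ^ 2) := by
  have hn := rrNum_eq (q := -q) (by rwa [norm_neg])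
  have h2 := rrNum_eq (norm_sq_lt_one hq1)
  rw [neg_sq] at hn
  rw [← pow_mul] at h2
  rw [rrNum_eq hq1, hn, h2, ← rrOdd₁_mul_neg hq1]
  ring

lemma rrDen_mul_neg {q : ℂ} (hq1 : ‖q‖ < 1) :
    rrDen q * rrDen (-q) * rrNum (q ^ 4) = rrNum (q ^ 2) ^ 2 * rrDen (q ^ 2) := by
  have hn := rrDen_eq (q := -q) (by rwa [norm_neg])
  have h2 := rrDen_eq (norm_sq_lt_one hq1)
  rw [neg_sq] at hn
  rw [← pow_mul] at h2
  rw [rrDen_eq hq1, hn, h2, ← rrOdd₃_mul_neg hq1]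
  ring

lemma R_neg {q : ℂ} (hq1 : ‖q‖ < 1) : R q * R (q ^ 2) * R (-q) = R (q ^ 4) := by
  have h4 := norm_pow_lt_one hq1 (n := 4) (by simp)
  have n1 := rrNum_mul_neg hq1
  have d1 := rrDen_mul_neg hq1
  have := rrDen_ne_zero hq1
  have := rrDen_ne_zero (q := -q) (by rwa [norm_neg])
  have := rrDen_ne_zero (norm_sq_lt_one hq1)
  have := rrDen_ne_zero h4
  have := rrNum_ne_zero (norm_sq_lt_one hq1)
  simp only [R_eq]
  field_simp
  refine mul_right_cancel₀ (b := rrNum (q ^ 2) * rrDen (q ^ 2)) (by positivity) ?_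
  linear_combination rrNum (q ^ 2) ^ 2 * rrDen (q ^ 2) * n1 -
    rrDen (q ^ 2) ^ 2 * rrNum (q ^ 2) * d1

lemma differentiableOn_qp_pow (m : ℕ) :
    DifferentiableOn ℂ (fun q => qp (q ^ m) (q ^ 5)) (Metric.ball (0 : ℂ) 1) := by
  have h : HasProdLocallyUniformlyOn (fun (k : ℕ) (q : ℂ) => 1 + -(q ^ m * (q ^ 5) ^ k))
      (fun q => ∏' k : ℕ, (1 + -(q ^ m * (q ^ 5) ^ k))) (Metric.ball (0 : ℂ) 1) := by
    apply hasProdLocallyUniformlyOn_of_forall_compact Metric.isOpen_ball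
    intro K hK hcK
    rcases K.eq_empty_or_nonempty with hN | hN
    · simpa [hasProdUniformlyOn_iff_tendstoUniformlyOn, hN] using tendstoUniformlyOn_empty
    · obtain ⟨q₀, hq₀, _, HB⟩ := hcK.exists_sSup_image_eq_and_ge hN
        (show ContinuousOn (fun q : ℂ => ‖q‖) K by fun_prop)
      have hq₀1 : ‖q₀‖ < 1 := by simpa using hK hq₀
      refine (summable_geometric_of_lt_one (norm_nonneg _)
        (norm_pow_lt_one hq₀1 (n := 5) (by simp))).hasProdUniformlyOn_nat_one_add
        hcK (.of_forall fun n x hx => ?_) (fun _ => by fun_prop)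
      have hx1 : ‖x‖ < 1 := by simpa using hK hx
      rw [norm_neg, norm_mul, norm_pow, norm_pow, norm_pow, norm_pow]
      have := HB x hx
      calc ‖x‖ ^ m * (‖x‖ ^ 5) ^ n ≤ 1 * (‖q₀‖ ^ 5) ^ n := by
            gcongr
            exact pow_le_one₀ (norm_nonneg _) hx1.le
        _ = _ := one_mul _
  have hd := h.differentiableOn (.of_forall fun _ => by
    simpa [Finset.prod_fn] using DifferentiableOn.finsetProd (fun _ _ => by fun_prop))
    Metric.isOpen_ball
  simpa only [qp, sub_eq_add_neg] using hd

lemma differentiableOn_R : DifferentiableOn ℂ R (Metric.ball (0 : ℂ) 1) := by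
  have h1 := differentiableOn_qp_pow 1
  simp only [pow_one] at h1
  refine (h1.mul (differentiableOn_qp_pow 4)).div
    ((differentiableOn_qp_pow 2).mul (differentiableOn_qp_pow 3)) fun q hq => ?_
  exact rrDen_ne_zero (by simpa using hq)

lemma differentiableOn_R_pow {n : ℕ} (hn : n ≠ 0) :
    DifferentiableOn ℂ (fun q => R (q ^ n)) (Metric.ball (0 : ℂ) 1) :=
  differentiableOn_R.comp (by fun_prop) fun q hq => by
    simpa using pow_lt_one₀ (norm_nonneg _) (by simpa using hq) hn

/-- A quadratic equation satisfied by `R(q)` over the field generated by `R(q^2)` and `R(q^4)`. -/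
lemma R_quadratic {q : ℂ} (hq1 : ‖q‖ < 1) :
    R (q ^ 2) * R q ^ 2 + q * R (q ^ 4) * (R (q ^ 4) + R (q ^ 2) ^ 2) * R q - R (q ^ 4) = 0 := by
  have hd1 := differentiableOn_R
  have hd2 := differentiableOn_R_pow (n := 2) (by simp)
  have hd4 := differentiableOn_R_pow (n := 4) (by simp)
  have hF : DifferentiableOn ℂ (fun q => R (q ^ 2) * R q ^ 2 +
      q * R (q ^ 4) * (R (q ^ 4) + R (q ^ 2) ^ 2) * R q - R (q ^ 4)) (Metric.ball (0 : ℂ) 1) := by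
    fun_prop
  have hA : DifferentiableOn ℂ (fun q => 1 + q * R q * R (q ^ 4)) (Metric.ball (0 : ℂ) 1) := by
    fun_prop
  have hball : Metric.ball (0 : ℂ) 1 ∈ 𝓝 0 := Metric.ball_mem_nhds 0 one_pos
  have hA0 : ∀ᶠ q in 𝓝 (0 : ℂ), 1 + q * R q * R (q ^ 4) ≠ 0 :=
    (hA.continuousOn.continuousAt hball).eventually_ne (by simp)
  refine (hF.analyticOnNhd Metric.isOpen_ball).eqOn_zero_of_preconnected_of_eventuallyEq_zero
    (convex_ball 0 1).isPreconnected (Metric.mem_ball_self one_pos) ?_ (by simpa using hq1)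
  filter_upwards [hA0, hball] with q hq hqb
  have hq1 : ‖q‖ < 1 := by simpa using hqb
  have r1 := R_modular_equation hq1
  have r2 := R_modular_equation (norm_sq_lt_one hq1)
  rw [← pow_mul] at r2
  norm_num at r2
  have hb : R (q ^ 2) ≠ 0 := by
    rw [R_eq]
    exact div_ne_zero (rrNum_ne_zero (norm_sq_lt_one hq1)) (rrDen_ne_zero (norm_sq_lt_one hq1))
  have hc : R (q ^ 4) ≠ 0 := by
    have h4 := norm_pow_lt_one hq1 (n := 4) (by simp)
    rw [R_eq]
    exact div_ne_zero (rrNum_ne_zero h4) (rrDen_ne_zero h4)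
  simp only [Pi.zero_apply]
  refine (mul_eq_zero.mp ?_).resolve_left (mul_ne_zero (mul_ne_zero hb hc) hq)
  generalize R (q ^ 4) = c at *
  generalize R (q ^ 2) = b at *
  generalize R q = a at *
  linear_combination -c ^ 2 * r1 - a ^ 2 * c * r2

theorem stmt_8 : ∀ q : ℂ, ‖q‖ < 1 →
    R q / (R (q ^ 2) * R (q ^ 4)) - q ^ 2 * R (q ^ 2) * R (q ^ 4) / R q
      = E q * E (q ^ 4) * E (q ^ 10) ^ 10 / (E (q ^ 2) ^ 2 * E (q ^ 5) ^ 5 * E (q ^ 20) ^ 5) := by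
  intro q hq1
  rcases eq_or_ne q 0 with rfl | hq
  · simp [R, qp, E]
  have hn : ‖-q‖ < 1 := by rwa [norm_neg]
  have hlt2 := norm_sq_lt_one hq1
  have hlt4 := norm_pow_lt_one hq1 (n := 4) (by simp)
  have hlt5 := norm_pow_lt_one hq1 (n := 5) (by simp)
  have hadd := R_sq_add (neg_ne_zero.mpr hq) hn
  have hodd : (-q) ^ 5 = -q ^ 5 := by ring
  have heven : (-q) ^ 10 = q ^ 10 := by ring
  rw [neg_sq, hodd, heven] at hadd
  have hneg := R_neg hq1
  have hnum := rrNum_mul_neg hq1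
  have hE := E_mul_E_neg hlt5
  have r2 := R_modular_equation hlt2
  have hQ := R_quadratic hq1
  have m1 := rrNum_mul_rrDen hq1
  have m2 := rrNum_mul_rrDen hlt2
  have m4 := rrNum_mul_rrDen hlt4
  simp only [← pow_mul, Nat.reduceMul] at hE r2 m2 m4
  have g1 := rrNum_ne_zero hq1
  have g2 := rrNum_ne_zero hlt2
  have g4 := rrNum_ne_zero hlt4
  have h1 := rrDen_ne_zero hq1
  have h2 := rrDen_ne_zero hlt2
  have h4 := rrDen_ne_zero hlt4
  have E5 := E_ne_zero hlt5
  have E10 := E_ne_zero (norm_pow_lt_one hq1 (n := 10) (by simp))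
  have E20 := E_ne_zero (norm_pow_lt_one hq1 (n := 20) (by simp))
  have ha : R q * rrDen q = rrNum q := by rw [R_eq]; field_simp
  have hb : R (q ^ 2) * rrDen (q ^ 2) = rrNum (q ^ 2) := by rw [R_eq]; field_simp
  have hc : R (q ^ 4) * rrDen (q ^ 4) = rrNum (q ^ 4) := by rw [R_eq]; field_simp
  have a0 : R q ≠ 0 := left_ne_zero_of_mul (ha ▸ g1)
  have b0 : R (q ^ 2) ≠ 0 := left_ne_zero_of_mul (hb ▸ g2)
  have c0 : R (q ^ 4) ≠ 0 := left_ne_zero_of_mul (hc ▸ g4)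
  rw [← m1, ← m2, ← m4]
  clear m1 m2 m4 hlt2 hlt4 hlt5 hn hq1 hodd heven
  generalize R q = a at *
  generalize R (q ^ 2) = b at *
  generalize R (q ^ 4) = c at *
  generalize R (-q) = d at *
  generalize rrNum q = g₁ at *
  generalize rrNum (-q) = gₙ at *
  generalize rrNum (q ^ 2) = g₂ at *
  generalize rrNum (q ^ 4) = g₄ at *
  generalize rrDen q = h₁ at *
  generalize rrDen (q ^ 2) = h₂ at *
  generalize rrDen (q ^ 4) = h₄ at *
  generalize E (q ^ 5) = e₅ at *
  generalize E (-q ^ 5) = eₙ at *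
  generalize E (q ^ 10) = e₁₀ at *
  generalize E (q ^ 20) = e₂₀ at *
  have hsum : (a ^ 2 * b ^ 3 + c ^ 2) * (e₁₀ ^ 4 * g₁ * h₄) =
      2 * a ^ 2 * b ^ 2 * h₂ ^ 2 * e₅ ^ 2 * e₂₀ ^ 2 := by
    have hadd' : (a ^ 2 * b ^ 3 + c ^ 2) * (g₂ * eₙ ^ 2) = 2 * a ^ 2 * b ^ 2 * gₙ * e₁₀ ^ 2 := by
      rw [← hneg]
      linear_combination a ^ 2 * b ^ 2 * hadd
    have hE' : e₅ ^ 2 * eₙ ^ 2 * e₂₀ ^ 2 = e₁₀ ^ 6 := by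
      linear_combination (e₅ * eₙ * e₂₀ + e₁₀ ^ 3) * hE
    refine mul_right_cancel₀ (b := g₂ * e₁₀ ^ 2) (by positivity) ?_
    linear_combination g₁ * h₄ * e₅ ^ 2 * e₂₀ ^ 2 * hadd' +
      2 * a ^ 2 * b ^ 2 * e₁₀ ^ 2 * e₅ ^ 2 * e₂₀ ^ 2 * hnum -
      (a ^ 2 * b ^ 3 + c ^ 2) * g₂ * g₁ * h₄ * hE'
  have hprod : (1 - q * a * c) * (a ^ 2 * b ^ 3 + c ^ 2) = 2 * a ^ 2 * b * c := by
    linear_combination (b ^ 2 * (1 - q * a * c) - (c + b ^ 2)) * hQ - b * a ^ 2 * r2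
  have hdiff : a ^ 2 - q ^ 2 * b ^ 2 * c ^ 2 = b * (1 - q * a * c) ^ 2 := by
    refine mul_left_cancel₀ b0 ?_
    linear_combination -(q ^ 2 * b * c ^ 2 - 1) * hQ - (q * a * c - 1) * r2
  have hD : (1 - q * a * c) * (g₂ * h₂ * e₅ ^ 2 * e₂₀ ^ 2) = e₁₀ ^ 4 * g₁ * g₄ := by
    rw [← hb, ← hc]
    refine mul_left_cancel₀ (mul_ne_zero (mul_ne_zero two_ne_zero (pow_ne_zero 2 a0)) b0) ?_
    linear_combination e₁₀ ^ 4 * g₁ * h₄ * hprod - (1 - q * a * c) * hsum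
  have hlhs : a / (b * c) - q ^ 2 * b * c / a = (1 - q * a * c) ^ 2 / (a * c) := by
    field_simp
    linear_combination hdiff
  have hK : g₂ * h₂ * e₅ ^ 2 * e₂₀ ^ 2 ≠ 0 := by positivity
  rw [hlhs, eq_div_of_mul_eq hK hD, ← ha, ← hc]
  field_simp
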